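/- The commutator [D_α + D′_α, Λ_Y] vanishes on 𝒫_Y: for every f ∈ 𝒫_Y, (D_α + D′_α)(Λ_Y f) = Λ_Y((D_α + D′_α) f). -/

import Mathlib

open MvPolynomial

noncomputable section

/-- The base field `K = ℚ(b)`: rational functions in an indeterminate `b` over `ℚ`. -/
abbrev K : Type := RatFunc ℚ

/-- The indeterminate `b ∈ K`. -/
def bb : K := RatFunc.X

/-- `α = 1 + b`. -/
def alpha : K := 1 + bb

/-- Variables: `p i` (used for `i ≥ 1`) and `y i` (used for `i ≥ 0`). -/
inductive Var : Type
  | p : ℕ → Var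
  | y : ℕ → Var
  deriving DecidableEq

/-- The ambient polynomial ring `R = K[p₁, p₂, …, y₀, y₁, …]`. -/
abbrev R : Type := MvPolynomial Var K

/-- The variable `p_i`. -/
def P (i : ℕ) : R := X (Var.p i)

/-- The variable `y_i`. -/
def Y (i : ℕ) : R := X (Var.y i)

/-- Partial derivative `∂/∂p_i`. -/
def dP (i : ℕ) (f : R) : R := pderiv (Var.p i) f

/-- Partial derivative `∂/∂y_i`. -/
def dY (i : ℕ) (f : R) : R := pderiv (Var.y i) f

/-- `𝒫`: the subalgebra of polynomials in the `p`-variables only. -/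
def Psub : Subalgebra K R := MvPolynomial.supported K (Set.range Var.p)

/-- `𝒫_Y`: the `K`-linear span of the monomials `p_λ` and `y_i·p_λ`. -/
def PY : Submodule K R :=
  Submodule.span K ((Psub : Set R) ∪ {g : R | ∃ i : ℕ, ∃ f ∈ (Psub : Set R), g = Y i * f})

/-- The Laplace–Beltrami operator
`D_α = (1/2)(α Σ_{i,j≥1} i j p_{i+j} ∂²/∂p_i∂p_j + Σ_{i,j≥1} (i+j) p_i p_j ∂/∂p_{i+j}
        + b Σ_{i≥1} i(i−1) p_i ∂/∂p_i)`. -/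
def Dalpha (f : R) : R :=
  (2 : K)⁻¹ •
    (alpha • (∑ᶠ (i : ℕ) (j : ℕ), (((i + 1) * (j + 1) : ℕ) : K) •
        (P (i + 1 + (j + 1)) * dP (i + 1) (dP (j + 1) f)))
      + (∑ᶠ (i : ℕ) (j : ℕ), (((i + 1) + (j + 1) : ℕ) : K) •
        (P (i + 1) * P (j + 1) * dP (i + 1 + (j + 1)) f))
      + bb • (∑ᶠ (i : ℕ), (((i + 1) * i : ℕ) : K) • (P (i + 1) * dP (i + 1) f)))

/-- `Λ_Y = α Σ_{i,j≥1} i y_{i+j−1} ∂²/∂p_i∂y_{j−1} + Σ_{i,j≥1} y_{i−1} p_j ∂/∂y_{i+j−1}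
      + b Σ_{i≥1} i y_i ∂/∂y_i`. -/
def LamY (f : R) : R :=
  alpha • (∑ᶠ (i : ℕ) (j : ℕ), ((i + 1 : ℕ) : K) • (Y (i + j + 1) * dP (i + 1) (dY j f)))
    + (∑ᶠ (i : ℕ) (j : ℕ), Y i * P (j + 1) * dY (i + j + 1) f)
    + bb • (∑ᶠ (i : ℕ), ((i + 1 : ℕ) : K) • (Y (i + 1) * dY (i + 1) f))

/-- `Y_+ = Σ_{i≥0} y_{i+1} ∂/∂y_i`. -/
def Yplus (f : R) : R := ∑ᶠ (i : ℕ), Y (i + 1) * dY i f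

/-- `Θ_Y = Σ_{i≥1} p_i ∂/∂y_i`. -/
def ThetaY (f : R) : R := ∑ᶠ (i : ℕ), P (i + 1) * dY (i + 1) f

/-- `A j` is the operator `A_{j+1}` of the paper:
`A_{j+1} f = (1/(1+b))·Θ_Y(Y_+(Λ_Y^j(y₀·f)))`. -/
def A (j : ℕ) (f : R) : R := (1 + bb)⁻¹ • ThetaY (Yplus (LamY^[j] (Y 0 * f)))

/-- `D'_α = α Σ_{i,j≥1} i j y_{i+j} ∂²/∂y_i∂p_j + Σ_{i,j≥1} i y_i p_j ∂/∂y_{i+j}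
      + (b/2) Σ_{i≥1} i(i−1) y_i ∂/∂y_i`. -/
def D'alpha (f : R) : R :=
  alpha • (∑ᶠ (i : ℕ) (j : ℕ), (((i + 1) * (j + 1) : ℕ) : K) •
      (Y (i + 1 + (j + 1)) * dY (i + 1) (dP (j + 1) f)))
    + (∑ᶠ (i : ℕ) (j : ℕ), ((i + 1 : ℕ) : K) • (Y (i + 1) * P (j + 1) * dY (i + 1 + (j + 1)) f))
    + (bb * (2 : K)⁻¹) • (∑ᶠ (i : ℕ), (((i + 1) * i : ℕ) : K) • (Y (i + 1) * dY (i + 1) f))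

/-- `P i`, with the convention that the value at index `0` is `0`. -/
def pHat (i : ℕ) : R := if i = 0 then 0 else P i

@[simp] lemma pHat_zero : pHat 0 = 0 := rfl

@[simp] lemma pHat_succ (i : ℕ) : pHat (i + 1) = P (i + 1) := rfl

@[simp] lemma dP_zero (i : ℕ) : dP i 0 = 0 := by simp [dP]

@[simp] lemma dY_zero (i : ℕ) : dY i 0 = 0 := by simp [dY]

lemma dP_add (i : ℕ) (f g : R) : dP i (f + g) = dP i f + dP i g := by simp [dP]

lemma dY_add (i : ℕ) (f g : R) : dY i (f + g) = dY i f + dY i g := by simp [dY]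

lemma dP_smul (i : ℕ) (c : K) (f : R) : dP i (c • f) = c • dP i f := by simp [dP]

lemma dY_smul (i : ℕ) (c : K) (f : R) : dY i (c • f) = c • dY i f := by simp [dY]

lemma dP_sum {ι : Type*} (i : ℕ) (s : Finset ι) (f : ι → R) :
    dP i (∑ x ∈ s, f x) = ∑ x ∈ s, dP i (f x) := by simp [dP]

lemma dY_sum {ι : Type*} (i : ℕ) (s : Finset ι) (f : ι → R) :
    dY i (∑ x ∈ s, f x) = ∑ x ∈ s, dY i (f x) := by simp [dY]

lemma dP_mul (i : ℕ) (f g : R) : dP i (f * g) = f * dP i g + dP i f * g := by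
  simp [dP, Derivation.leibniz, mul_comm]

lemma dY_mul (i : ℕ) (f g : R) : dY i (f * g) = f * dY i g + dY i f * g := by
  simp [dY, Derivation.leibniz, mul_comm]

lemma dP_Y (i j : ℕ) : dP i (Y j) = 0 := by
  simp [dP, Y, pderiv_X]

lemma dY_Y (i j : ℕ) : dY i (Y j) = if i = j then 1 else 0 := by
  simp [dY, Y, pderiv_X, Pi.single_apply, eq_comm]

lemma dY_pHat (i j : ℕ) : dY i (pHat j) = 0 := by
  unfold pHat
  split_ifs
  · simp
  · simp [dY, P, pderiv_X]

lemma dP_pHat {i : ℕ} (hi : i ≠ 0) (j : ℕ) : dP i (pHat j) = if i = j then 1 else 0 := by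
  unfold pHat
  split_ifs <;> simp_all [dP, P, pderiv_X, eq_comm]

lemma pderiv_comm (u v : Var) (f : R) : pderiv u (pderiv v f) = pderiv v (pderiv u f) := by
  have h : ⁅(pderiv u : Derivation K R R), (pderiv v : Derivation K R R)⁆ = 0 := by
    ext w
    simp [Derivation.commutator_apply, pderiv_X, Pi.single_apply, apply_ite]
  have := congrArg (fun D : Derivation K R R => D f) h
  simpa [Derivation.commutator_apply, sub_eq_zero] using this

lemma dP_dP_comm (i j : ℕ) (f : R) : dP i (dP j f) = dP j (dP i f) := pderiv_comm _ _ f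

lemma dP_dY_comm (i j : ℕ) (f : R) : dP i (dY j f) = dY j (dP i f) := pderiv_comm _ _ f

lemma finsum_succ_eq_sum_range {F : ℕ → R} {T : ℕ} (h0 : F 0 = 0) (h : ∀ i, T ≤ i → F i = 0) :
    ∑ᶠ i, F (i + 1) = ∑ i ∈ Finset.range T, F i := by
  rw [finsum_eq_sum_of_support_subset (s := Finset.range T)]
  · have := Finset.sum_range_succ F T
    rw [Finset.sum_range_succ', h0, h T le_rfl, add_zero, add_zero] at this
    exact this
  · intro i hi
    by_contra hc
    exact hi (h _ (by simp at hc; omega))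

lemma finsum_eq_sum_range {F : ℕ → R} {T : ℕ} (h : ∀ i, T ≤ i → F i = 0) :
    ∑ᶠ i, F i = ∑ i ∈ Finset.range T, F i := by
  rw [finsum_eq_sum_of_support_subset (s := Finset.range T)]
  intro i hi
  by_contra hc
  exact hi (h _ (by simpa using hc))

lemma finsum_finsum_succ_eq_sum_range {F : ℕ → ℕ → R} {T : ℕ} (h0 : ∀ j, F 0 j = 0)
    (h0' : ∀ i, F i 0 = 0) (h : ∀ i j, T ≤ i → F i j = 0) (h' : ∀ i j, T ≤ j → F i j = 0) :
    ∑ᶠ (i : ℕ) (j : ℕ), F (i + 1) (j + 1) =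
      ∑ i ∈ Finset.range T, ∑ j ∈ Finset.range T, F i j := by
  simp_rw [fun i => finsum_succ_eq_sum_range (h0' (i + 1)) (h' (i + 1))]
  exact finsum_succ_eq_sum_range (F := fun i => ∑ j ∈ Finset.range T, F i j)
    (by simp [h0]) (fun i hi => by simp [h i _ hi])

/-- All derivatives of `f` with respect to variables of index at least `T` vanish. -/
def BoundedBy (T : ℕ) (f : R) : Prop := ∀ i, T ≤ i → dP i f = 0 ∧ dY i f = 0

lemma exists_boundedBy (f : R) : ∃ T, ∀ S, T ≤ S → BoundedBy S f := by
  obtain ⟨T, hT⟩ := Finset.exists_nat_subset_range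
    (f.vars.image fun v : Var => (Var.rec id id v : ℕ))
  refine ⟨T, fun S hS i hi => ⟨?_, ?_⟩⟩ <;>
  · refine pderiv_eq_zero_of_notMem_vars fun hv => ?_
    have := Finset.mem_range.1 (hT (Finset.mem_image_of_mem _ hv))
    simp at this
    omega

/-- `Dalpha` with all sums truncated at `T`. -/
def truncD (T : ℕ) (f : R) : R :=
  (2 : K)⁻¹ • (alpha • (∑ i ∈ Finset.range T, ∑ j ∈ Finset.range T,
        ((i * j : ℕ) : K) • (pHat (i + j) * dP i (dP j f)))
    + (∑ i ∈ Finset.range T, ∑ j ∈ Finset.range T,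
        ((i + j : ℕ) : K) • (pHat i * pHat j * dP (i + j) f))
    + bb • ∑ i ∈ Finset.range T, ((i * (i - 1) : ℕ) : K) • (pHat i * dP i f))

/-- `LamY` with all sums truncated at `T`. -/
def truncLam (T : ℕ) (f : R) : R :=
  alpha • (∑ i ∈ Finset.range T, ∑ j ∈ Finset.range T, (i : K) • (Y (i + j) * dP i (dY j f)))
    + (∑ i ∈ Finset.range T, ∑ j ∈ Finset.range T, Y i * pHat j * dY (i + j) f)
    + bb • ∑ i ∈ Finset.range T, (i : K) • (Y i * dY i f)

/-- `D'alpha` with all sums truncated at `T`. -/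
def truncD' (T : ℕ) (f : R) : R :=
  alpha • (∑ i ∈ Finset.range T, ∑ j ∈ Finset.range T,
        ((i * j : ℕ) : K) • (Y (i + j) * dY i (dP j f)))
    + (∑ i ∈ Finset.range T, ∑ j ∈ Finset.range T, (i : K) • (Y i * pHat j * dY (i + j) f))
    + (bb * (2 : K)⁻¹) • ∑ i ∈ Finset.range T, ((i * (i - 1) : ℕ) : K) • (Y i * dY i f)

lemma Dalpha_eq_truncD {T : ℕ} {f : R} (hf : BoundedBy T f) : Dalpha f = truncD T f := by
  unfold Dalpha truncD
  congr 3
  · congr 1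
    refine finsum_finsum_succ_eq_sum_range
      (F := fun i j => ((i * j : ℕ) : K) • (pHat (i + j) * dP i (dP j f))) ?_ ?_ ?_ ?_
    · simp
    · simp
    · intro i j h; simp [dP_dP_comm i j, (hf i h).1]
    · intro i j h; simp [(hf j h).1]
  · refine finsum_finsum_succ_eq_sum_range
      (F := fun i j => ((i + j : ℕ) : K) • (pHat i * pHat j * dP (i + j) f)) ?_ ?_ ?_ ?_
    · simp
    · simp
    · intro i j h; simp [(hf (i + j) (by omega)).1]
    · intro i j h; simp [(hf (i + j) (by omega)).1]
  · refine finsum_succ_eq_sum_range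
      (F := fun i => ((i * (i - 1) : ℕ) : K) • (pHat i * dP i f)) ?_ ?_
    · simp
    · intro i h; simp [(hf i h).1]

lemma D'alpha_eq_truncD' {T : ℕ} {f : R} (hf : BoundedBy T f) : D'alpha f = truncD' T f := by
  unfold D'alpha truncD'
  congr 2
  · congr 1
    refine finsum_finsum_succ_eq_sum_range
      (F := fun i j => ((i * j : ℕ) : K) • (Y (i + j) * dY i (dP j f))) ?_ ?_ ?_ ?_
    · simp
    · simp
    · intro i j h; simp [← dP_dY_comm j i, (hf i h).2]
    · intro i j h; simp [(hf j h).1]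
  · refine finsum_finsum_succ_eq_sum_range
      (F := fun i j => (i : K) • (Y i * pHat j * dY (i + j) f)) ?_ ?_ ?_ ?_
    · simp
    · simp
    · intro i j h; simp [(hf (i + j) (by omega)).2]
    · intro i j h; simp [(hf (i + j) (by omega)).2]
  · refine finsum_succ_eq_sum_range
      (F := fun i => ((i * (i - 1) : ℕ) : K) • (Y i * dY i f)) ?_ ?_
    · simp
    · intro i h; simp [(hf i h).2]

lemma LamY_eq_truncLam {T : ℕ} {f : R} (hf : BoundedBy T f) : LamY f = truncLam T f := by
  unfold LamY truncLam
  congr 2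
  · congr 1
    have h1 (i : ℕ) : ∑ᶠ j, ((i + 1 : ℕ) : K) • (Y (i + j + 1) * dP (i + 1) (dY j f)) =
        ∑ j ∈ Finset.range T, ((i + 1 : ℕ) : K) • (Y (i + 1 + j) * dP (i + 1) (dY j f)) := by
      simp_rw [add_right_comm i _ 1]
      exact finsum_eq_sum_range fun j h => by simp [(hf j h).2]
    simp_rw [h1]
    refine finsum_succ_eq_sum_range
      (F := fun i => ∑ j ∈ Finset.range T, (i : K) • (Y (i + j) * dP i (dY j f))) ?_ ?_
    · simp
    · intro i h; simp [dP_dY_comm i, (hf i h).1]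
  · have h1 (i : ℕ) : ∑ᶠ j, Y i * P (j + 1) * dY (i + j + 1) f =
        ∑ j ∈ Finset.range T, Y i * pHat j * dY (i + j) f := by
      refine finsum_succ_eq_sum_range (F := fun j => Y i * pHat j * dY (i + j) f) ?_ ?_
      · simp
      · intro j h; simp [(hf (i + j) (by omega)).2]
    simp_rw [h1]
    exact finsum_eq_sum_range fun i h =>
      Finset.sum_eq_zero fun j _ => by simp [(hf (i + j) (by omega)).2]
  · refine finsum_succ_eq_sum_range (F := fun i => (i : K) • (Y i * dY i f)) ?_ ?_
    · simp
    · intro i h; simp [(hf i h).2]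

lemma truncD_add (T : ℕ) (f g : R) : truncD T (f + g) = truncD T f + truncD T g := by
  simp only [truncD, dP_add, mul_add, smul_add, Finset.sum_add_distrib]
  abel

lemma truncD'_add (T : ℕ) (f g : R) : truncD' T (f + g) = truncD' T f + truncD' T g := by
  simp only [truncD', dP_add, dY_add, mul_add, smul_add, Finset.sum_add_distrib]
  abel

lemma truncLam_add (T : ℕ) (f g : R) : truncLam T (f + g) = truncLam T f + truncLam T g := by
  simp only [truncLam, dP_add, dY_add, mul_add, smul_add, Finset.sum_add_distrib]
  abel

lemma truncD_smul (T : ℕ) (c : K) (f : R) : truncD T (c • f) = c • truncD T f := by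
  simp only [truncD, dP_smul, mul_smul_comm, smul_add, Finset.smul_sum, smul_comm _ c]

lemma truncD'_smul (T : ℕ) (c : K) (f : R) : truncD' T (c • f) = c • truncD' T f := by
  simp only [truncD', dP_smul, dY_smul, mul_smul_comm, smul_add, Finset.smul_sum, smul_comm _ c]

lemma truncLam_smul (T : ℕ) (c : K) (f : R) : truncLam T (c • f) = c • truncLam T f := by
  simp only [truncLam, dP_smul, dY_smul, mul_smul_comm, smul_add, Finset.smul_sum, smul_comm _ c]

/-- An operator agreeing with linear truncations is linear. -/
def linearOfTrunc (F : R → R) (G : ℕ → R → R)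
    (hFG : ∀ {T : ℕ} {f : R}, BoundedBy T f → F f = G T f)
    (hadd : ∀ T f g, G T (f + g) = G T f + G T g)
    (hsmul : ∀ T (c : K) f, G T (c • f) = c • G T f) : R →ₗ[K] R where
  toFun := F
  map_add' f g := by
    obtain ⟨A, hA⟩ := exists_boundedBy f
    obtain ⟨B, hB⟩ := exists_boundedBy g
    have hf := hA (max A B) (le_max_left _ _)
    have hg := hB (max A B) (le_max_right _ _)
    have hfg : BoundedBy (max A B) (f + g) := fun i hi => by
      simp [dP_add, dY_add, hf i hi, hg i hi]
    rw [hFG hf, hFG hg, hFG hfg, hadd]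
  map_smul' c f := by
    obtain ⟨A, hA⟩ := exists_boundedBy f
    have hf := hA A le_rfl
    have hcf : BoundedBy A (c • f) := fun i hi => by
      simp [dP_smul, dY_smul, hf i hi]
    rw [hFG hf, hFG hcf, hsmul, RingHom.id_apply]

/-- `Dalpha` as a linear map. -/
def linD : R →ₗ[K] R := linearOfTrunc Dalpha truncD Dalpha_eq_truncD truncD_add truncD_smul

/-- `D'alpha` as a linear map. -/
def linD' : R →ₗ[K] R := linearOfTrunc D'alpha truncD' D'alpha_eq_truncD' truncD'_add truncD'_smul

/-- `LamY` as a linear map. -/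
def linLam : R →ₗ[K] R := linearOfTrunc LamY truncLam LamY_eq_truncLam truncLam_add truncLam_smul

lemma linD_apply (f : R) : linD f = Dalpha f := rfl

lemma linD'_apply (f : R) : linD' f = D'alpha f := rfl

lemma linLam_apply (f : R) : linLam f = LamY f := rfl

lemma dP_pHat_of_ne_zero (i : ℕ) {j : ℕ} (hj : j ≠ 0) :
    dP i (pHat j) = if i = j then 1 else 0 := by
  simp [dP, pHat, hj, P, pderiv_X, Pi.single_apply, eq_comm]

lemma sum_range_sum_range_ite_add {k T : ℕ} (hk : k < T) (F : ℕ → ℕ → R) :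
    (∑ i ∈ Finset.range T, ∑ j ∈ Finset.range T, if i + j = k then F i j else 0) =
      ∑ t ∈ Finset.range (k + 1), F t (k - t) := by
  have h1 (i : ℕ) : (∑ j ∈ Finset.range T, if i + j = k then F i j else 0) =
      if i ∈ Finset.range (k + 1) then F i (k - i) else 0 := by
    split_ifs with hi
    · rw [Finset.mem_range] at hi
      rw [Finset.sum_eq_single (k - i), if_pos (by omega)]
      · intro j _ hj
        rw [if_neg (by omega)]
      · intro h
        simp at h
        omega
    · rw [Finset.mem_range] at hi
      exact Finset.sum_eq_zero fun j _ => if_neg (by omega)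
  simp_rw [h1]
  rw [Finset.sum_ite_mem, Finset.inter_eq_right.2]
  exact Finset.range_subset_range.2 (by omega)

lemma C_inv_two_mul_two : (C (2 : K)⁻¹ : R) * 2 = 1 := by
  rw [← map_ofNat (C : K →+* R) 2, ← map_mul, inv_mul_cancel₀ two_ne_zero, map_one]

lemma sum_natCast_smul_of_symm {n : ℕ} {c : ℕ → R} (hc : ∀ t ≤ n, c (n - t) = c t) :
    ∑ t ∈ Finset.range (n + 1), (t : K) • c t =
      ((n : K) * 2⁻¹) • ∑ t ∈ Finset.range (n + 1), c t := by
  have h : ∑ t ∈ Finset.range (n + 1), (t : K) • c t =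
      (n : K) • ∑ t ∈ Finset.range (n + 1), c t - ∑ t ∈ Finset.range (n + 1), (t : K) • c t := by
    conv_lhs => rw [← Finset.sum_flip]
    rw [Finset.smul_sum, ← Finset.sum_sub_distrib]
    refine Finset.sum_congr rfl fun t ht => ?_
    have ht' : t ≤ n := by simpa [Nat.lt_succ_iff] using ht
    rw [hc t ht', Nat.cast_sub ht', sub_smul]
  simp only [smul_eq_C_mul, map_mul] at h ⊢
  linear_combination C 2⁻¹ * h - (∑ t ∈ Finset.range (n + 1), C (t : K) * c t) * C_inv_two_mul_two

/-- Multiplication by `p_{k-m}` if `m < k`, and `α (m-k) ∂/∂p_{m-k}` otherwise: up to diagonal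
terms, the coefficient of `y_m` in the action of `LamY` on `y_k`. -/
def current (m k : ℕ) : R →ₗ[K] R :=
  if m < k then LinearMap.mulLeft K (pHat (k - m))
  else (alpha * ((m - k : ℕ) : K)) • (pderiv (Var.p (m - k))).toLinearMap

lemma current_add_right (m n : ℕ) (f : R) : current m (m + n) f = pHat n * f := by
  rcases Nat.eq_zero_or_pos n with rfl | hn
  · simp [current]
  · simp [current, hn]

lemma current_add_left (k n : ℕ) (f : R) :
    current (k + n) k f = (alpha * (n : K)) • dP n f := by
  simp [current, dP]

lemma current_self (k : ℕ) (f : R) : current k k f = 0 := by simp [current]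

lemma Dalpha_pHat_mul {n T : ℕ} {g : R} (hn : n ≠ 0) (hnT : n < T) (hg : BoundedBy T g) :
    Dalpha (pHat n * g) = pHat n * Dalpha g +
      (n : K) • (alpha • (∑ j ∈ Finset.range T, (j : K) • (pHat (n + j) * dP j g))
        + (2 : K)⁻¹ • (∑ t ∈ Finset.range (n + 1), pHat t * (pHat (n - t) * g))
        + (bb * 2⁻¹ * (n - 1)) • (pHat n * g)) := by
  have hb : BoundedBy T (pHat n * g) := fun i hi => by
    have : i ≠ n := by omega
    simp [dP_mul, dY_mul, hg i hi, dP_pHat_of_ne_zero _ hn, dY_pHat, this]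
  rw [Dalpha_eq_truncD hb, Dalpha_eq_truncD hg]
  have e1 : (∑ i ∈ Finset.range T, ∑ j ∈ Finset.range T,
        ((i * j : ℕ) : K) • (pHat (i + j) * dP i (dP j (pHat n * g)))) =
      pHat n * (∑ i ∈ Finset.range T, ∑ j ∈ Finset.range T,
        ((i * j : ℕ) : K) • (pHat (i + j) * dP i (dP j g)))
      + (2 * n : K) • (∑ j ∈ Finset.range T, (j : K) • (pHat (n + j) * dP j g)) := by
    have (i j : ℕ) : ((i * j : ℕ) : K) • (pHat (i + j) * dP i (dP j (pHat n * g))) =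
        pHat n * (((i * j : ℕ) : K) • (pHat (i + j) * dP i (dP j g)))
        + (if j = n then (n : K) • (i : K) • (pHat (n + i) * dP i g) else 0)
        + (if i = n then (n : K) • (j : K) • (pHat (n + j) * dP j g) else 0) := by
      have h1 : dP i (dP j (pHat n * g)) = pHat n * dP i (dP j g) +
          (if i = n then dP j g else 0) + (if j = n then dP i g else 0) := by
        simp only [dP_mul, dP_add, dP_pHat_of_ne_zero _ hn]
        split_ifs <;> simp [dP]
      rw [h1, mul_add, mul_add, smul_add, smul_add, mul_left_comm, mul_smul_comm, add_right_comm]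
      congr 2
      · split_ifs with h
        · subst h; rw [smul_smul, add_comm i j]; push_cast; ring_nf
        · simp
      · split_ifs with h
        · subst h; rw [smul_smul]; push_cast; ring_nf
        · simp
    simp_rw [this, Finset.sum_add_distrib, Finset.sum_ite_eq', ← Finset.mul_sum]
    rw [Finset.sum_comm (γ := ℕ) (f := fun i j => if i = n then _ else _)]
    simp_rw [Finset.sum_ite_eq', Finset.mem_range, if_pos hnT, ← Finset.smul_sum]
    simp only [smul_eq_C_mul, map_mul, map_ofNat]
    ring
  have e2 : (∑ i ∈ Finset.range T, ∑ j ∈ Finset.range T,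
        ((i + j : ℕ) : K) • (pHat i * pHat j * dP (i + j) (pHat n * g))) =
      pHat n * (∑ i ∈ Finset.range T, ∑ j ∈ Finset.range T,
        ((i + j : ℕ) : K) • (pHat i * pHat j * dP (i + j) g))
      + (n : K) • (∑ t ∈ Finset.range (n + 1), pHat t * (pHat (n - t) * g)) := by
    have (i j : ℕ) : ((i + j : ℕ) : K) • (pHat i * pHat j * dP (i + j) (pHat n * g)) =
        pHat n * (((i + j : ℕ) : K) • (pHat i * pHat j * dP (i + j) g))
        + (if i + j = n then (n : K) • (pHat i * (pHat j * g)) else 0) := by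
      rw [dP_mul, dP_pHat_of_ne_zero _ hn, mul_add, smul_add, mul_left_comm, mul_smul_comm]
      congr 1
      split_ifs with h
      · rw [h]; simp [mul_assoc]
      · simp
    simp_rw [this, Finset.sum_add_distrib, ← Finset.mul_sum, sum_range_sum_range_ite_add hnT,
      Finset.smul_sum]
  have e3 : (∑ i ∈ Finset.range T, ((i * (i - 1) : ℕ) : K) • (pHat i * dP i (pHat n * g))) =
      pHat n * (∑ i ∈ Finset.range T, ((i * (i - 1) : ℕ) : K) • (pHat i * dP i g))
      + ((n : K) * (n - 1)) • (pHat n * g) := by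
    have (i : ℕ) : ((i * (i - 1) : ℕ) : K) • (pHat i * dP i (pHat n * g)) =
        pHat n * (((i * (i - 1) : ℕ) : K) • (pHat i * dP i g))
        + (if i = n then ((n : K) * (n - 1)) • (pHat n * g) else 0) := by
      rw [dP_mul, dP_pHat_of_ne_zero _ hn, mul_add, smul_add, mul_left_comm, mul_smul_comm]
      congr 1
      split_ifs with h
      · subst h
        rw [Nat.cast_mul, Nat.cast_sub (by omega)]; simp
      · simp
    simp_rw [this, Finset.sum_add_distrib, ← Finset.mul_sum, Finset.sum_ite_eq',
      Finset.mem_range, if_pos hnT]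
  unfold truncD
  rw [e1, e2, e3]
  simp only [mul_smul_comm, mul_add, smul_add]
  have h2 := C_inv_two_mul_two
  simp only [smul_eq_C_mul, map_mul, map_ofNat, map_sub, map_one] at h2 ⊢
  grind

lemma dP_Dalpha {n T : ℕ} {g : R} (hn : n ≠ 0) (hnT : n < T) (hg : BoundedBy T g) :
    dP n (Dalpha g) = Dalpha (dP n g) +
      ((alpha * 2⁻¹) • (∑ t ∈ Finset.range (n + 1),
          ((t * (n - t : ℕ) : ℕ) : K) • dP (n - t) (dP t g))
        + (∑ j ∈ Finset.range T, ((n + j : ℕ) : K) • (pHat j * dP (n + j) g))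
        + (bb * 2⁻¹ * (n * (n - 1))) • dP n g) := by
  have hb : BoundedBy T (dP n g) := fun i hi => by
    simp [dP_dP_comm i n, ← dP_dY_comm, hg i hi]
  rw [Dalpha_eq_truncD hb, Dalpha_eq_truncD hg]
  have hcomm (i : ℕ) : dP n (dP i g) = dP i (dP n g) := dP_dP_comm _ _ _
  have hp (i : ℕ) : dP n (pHat i) = if i = n then 1 else 0 := by
    simp [dP_pHat hn, eq_comm]
  have e1 : dP n (∑ i ∈ Finset.range T, ∑ j ∈ Finset.range T,
        ((i * j : ℕ) : K) • (pHat (i + j) * dP i (dP j g))) =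
      (∑ i ∈ Finset.range T, ∑ j ∈ Finset.range T,
        ((i * j : ℕ) : K) • (pHat (i + j) * dP i (dP j (dP n g))))
      + ∑ t ∈ Finset.range (n + 1), ((t * (n - t : ℕ) : ℕ) : K) • dP (n - t) (dP t g) := by
    rw [← sum_range_sum_range_ite_add hnT
      (fun i j => ((i * j : ℕ) : K) • dP j (dP i g))]
    simp_rw [dP_sum, ← Finset.sum_add_distrib]
    refine Finset.sum_congr rfl fun i _ => Finset.sum_congr rfl fun j _ => ?_
    rw [dP_smul, dP_mul, dP_dP_comm n i, hcomm, hp, smul_add, dP_dP_comm j i]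
    split_ifs <;> simp
  have e2 : dP n (∑ i ∈ Finset.range T, ∑ j ∈ Finset.range T,
        ((i + j : ℕ) : K) • (pHat i * pHat j * dP (i + j) g)) =
      (∑ i ∈ Finset.range T, ∑ j ∈ Finset.range T,
        ((i + j : ℕ) : K) • (pHat i * pHat j * dP (i + j) (dP n g)))
      + (2 : K) • ∑ j ∈ Finset.range T, ((n + j : ℕ) : K) • (pHat j * dP (n + j) g) := by
    have (i j : ℕ) : dP n (((i + j : ℕ) : K) • (pHat i * pHat j * dP (i + j) g)) =
        ((i + j : ℕ) : K) • (pHat i * pHat j * dP (i + j) (dP n g))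
        + (if j = n then ((n + i : ℕ) : K) • (pHat i * dP (n + i) g) else 0)
        + (if i = n then ((n + j : ℕ) : K) • (pHat j * dP (n + j) g) else 0) := by
      rw [dP_smul, dP_mul, dP_mul, hcomm, hp, hp, add_mul, smul_add, smul_add, add_assoc]
      congr 2
      · split_ifs with h
        · subst h; simp [add_comm i j]
        · simp
      · split_ifs with h
        · subst h; simp
        · simp
    simp_rw [dP_sum, this, Finset.sum_add_distrib, Finset.sum_ite_eq']
    rw [Finset.sum_comm (γ := ℕ) (f := fun i j => if i = n then _ else _)]
    simp_rw [Finset.sum_ite_eq', Finset.mem_range, if_pos hnT]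
    simp only [smul_eq_C_mul, map_ofNat]
    ring
  have e3 : dP n (∑ i ∈ Finset.range T, ((i * (i - 1) : ℕ) : K) • (pHat i * dP i g)) =
      (∑ i ∈ Finset.range T, ((i * (i - 1) : ℕ) : K) • (pHat i * dP i (dP n g)))
      + ((n : K) * (n - 1)) • dP n g := by
    have (i : ℕ) : dP n (((i * (i - 1) : ℕ) : K) • (pHat i * dP i g)) =
        ((i * (i - 1) : ℕ) : K) • (pHat i * dP i (dP n g))
        + (if i = n then ((n : K) * (n - 1)) • dP n g else 0) := by
      rw [dP_smul, dP_mul, hcomm, hp, smul_add]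
      congr 1
      split_ifs with h
      · subst h
        rw [Nat.cast_mul, Nat.cast_sub (by omega)]; simp
      · simp
    simp_rw [dP_sum, this, Finset.sum_add_distrib, Finset.sum_ite_eq', Finset.mem_range,
      if_pos hnT]
  simp only [truncD, dP_smul, dP_add]
  rw [e1, e2, e3]
  have h2 := C_inv_two_mul_two
  simp only [smul_eq_C_mul, map_mul, map_ofNat, map_sub, map_one] at h2 ⊢
  grind

lemma sum_current_current_add_right (m n S : ℕ) (g : R) :
    ∑ l ∈ Finset.range (m + (n + S)), (((min m l : ℕ) : K) - ((min l (m + n) : ℕ) : K)) •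
        current m l (current l (m + n) g) =
      -((n : K) • (alpha • (∑ s ∈ Finset.range S, (s : K) • (pHat (n + s) * dP s g))
        + (2 : K)⁻¹ • (∑ t ∈ Finset.range (n + 1), pHat t * (pHat (n - t) * g)))) := by
  rw [Finset.sum_range_add, Finset.sum_range_add, Finset.sum_eq_zero, zero_add]
  · have h1 : ∀ t ∈ Finset.range n,
        (((min m (m + t) : ℕ) : K) - ((min (m + t) (m + n) : ℕ) : K)) •
          current m (m + t) (current (m + t) (m + n) g) =
        -((t : K) • (pHat t * (pHat (n - t) * g))) := by
      intro t ht
      obtain ⟨r, rfl⟩ := Nat.exists_eq_add_of_lt (Finset.mem_range.1 ht)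
      rw [min_eq_left (by omega), min_eq_left (by omega), current_add_right,
        show m + (t + r + 1) = (m + t) + (r + 1) by omega, current_add_right,
        show t + r + 1 - t = r + 1 by omega, ← neg_smul]
      push_cast
      ring_nf
    have h2 : ∀ s ∈ Finset.range S,
        (((min m (m + (n + s)) : ℕ) : K) - ((min (m + (n + s)) (m + n) : ℕ) : K)) •
          current m (m + (n + s)) (current (m + (n + s)) (m + n) g) =
        -((n : K) • alpha • (s : K) • (pHat (n + s) * dP s g)) := by
      intro s _
      rw [min_eq_left (by omega), min_eq_right (by omega), current_add_right,
        ← add_assoc m n s, current_add_left, mul_smul_comm, mul_smul, ← neg_smul]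
      push_cast
      ring_nf
    have h3 : ∑ t ∈ Finset.range n, (t : K) • (pHat t * (pHat (n - t) * g)) =
        ((n : K) * 2⁻¹) • ∑ t ∈ Finset.range (n + 1), pHat t * (pHat (n - t) * g) := by
      rw [← sum_natCast_smul_of_symm, Finset.sum_range_succ]
      · simp
      · intro t ht
        rw [Nat.sub_sub_self ht, mul_left_comm]
    rw [Finset.sum_congr rfl h1, Finset.sum_congr rfl h2, Finset.sum_neg_distrib,
      Finset.sum_neg_distrib, h3, smul_add, smul_smul _ (2 : K)⁻¹]
    simp only [Finset.smul_sum]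
    abel
  · intro l hl
    rw [Finset.mem_range] at hl
    rw [min_eq_right (by omega), min_eq_left (by omega), sub_self, zero_smul]

lemma sum_current_current_add_left (k n S : ℕ) (g : R) :
    ∑ l ∈ Finset.range (k + (n + S)), (((min (k + n) l : ℕ) : K) - ((min l k : ℕ) : K)) •
        current (k + n) l (current l k g) =
      (alpha * n) • ((alpha * 2⁻¹) • (∑ t ∈ Finset.range (n + 1),
          ((t * (n - t : ℕ) : ℕ) : K) • dP (n - t) (dP t g))
        + (∑ s ∈ Finset.range S, ((n + s : ℕ) : K) • (pHat s * dP (n + s) g))) := by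
  rw [Finset.sum_range_add, Finset.sum_range_add, Finset.sum_eq_zero, zero_add]
  · have h1 : ∀ t ∈ Finset.range n,
        (((min (k + n) (k + t) : ℕ) : K) - ((min (k + t) k : ℕ) : K)) •
          current (k + n) (k + t) (current (k + t) k g) =
        (alpha * alpha) • (t : K) • ((t * (n - t : ℕ) : ℕ) : K) • dP (n - t) (dP t g) := by
      intro t ht
      obtain ⟨r, rfl⟩ := Nat.exists_eq_add_of_lt (Finset.mem_range.1 ht)
      rw [min_eq_right (by omega), min_eq_right (by omega),
        show k + (t + r + 1) = (k + t) + (r + 1) by omega, current_add_left, current_add_left,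
        show t + r + 1 - t = r + 1 by omega, dP_smul]
      simp only [smul_smul]
      push_cast
      ring_nf
    have h2 : ∀ s ∈ Finset.range S,
        (((min (k + n) (k + (n + s)) : ℕ) : K) - ((min (k + (n + s)) k : ℕ) : K)) •
          current (k + n) (k + (n + s)) (current (k + (n + s)) k g) =
        (alpha * n) • ((n + s : ℕ) : K) • (pHat s * dP (n + s) g) := by
      intro s _
      rw [min_eq_left (by omega), min_eq_right (by omega), current_add_left,
        ← add_assoc k n s, current_add_right, mul_smul_comm]
      simp only [smul_smul]
      push_cast
      ring_nf
    have h3 : ∑ t ∈ Finset.range n,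
          (t : K) • ((t * (n - t : ℕ) : ℕ) : K) • dP (n - t) (dP t g) =
        ((n : K) * 2⁻¹) • ∑ t ∈ Finset.range (n + 1),
          ((t * (n - t : ℕ) : ℕ) : K) • dP (n - t) (dP t g) := by
      rw [← sum_natCast_smul_of_symm, Finset.sum_range_succ]
      · simp
      · intro t ht
        rw [Nat.sub_sub_self ht, dP_dP_comm, mul_comm]
    rw [Finset.sum_congr rfl h1, Finset.sum_congr rfl h2, ← Finset.smul_sum, ← Finset.smul_sum,
      h3, smul_add, ← mul_smul, ← mul_smul]
    ring_nf
  · intro l hl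
    rw [Finset.mem_range] at hl
    rw [min_eq_right (by omega), min_eq_left (by omega), sub_self, zero_smul]

lemma current_eq_zero {k l S : ℕ} {g : R} (hg : BoundedBy S g) (h : k + S ≤ l) :
    current l k g = 0 := by
  obtain ⟨n, rfl⟩ := Nat.exists_eq_add_of_le h
  rw [add_assoc, current_add_left, (hg _ (by omega)).1, smul_zero]

/-- The coefficient of `y_m` in the commutator relation applied to `y_k * g`. -/
lemma Dalpha_current (m : ℕ) {k S M : ℕ} {g : R} (hg : BoundedBy S g) (hM : k + S ≤ M) :
    Dalpha (current m k g) + ∑ l ∈ Finset.range M,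
        (((min m l : ℕ) : K) - ((min l k : ℕ) : K)) • current m l (current l k g)
      + (bb * 2⁻¹ * (m * (m - 1) - k * (k - 1)) + bb * (min m k : ℕ) * (k - m)) • current m k g =
      current m k (Dalpha g) := by
  have hsum {N : ℕ} (hN : k + S ≤ N) : ∑ l ∈ Finset.range N,
        (((min m l : ℕ) : K) - ((min l k : ℕ) : K)) • current m l (current l k g) =
      ∑ l ∈ Finset.range (k + S),
        (((min m l : ℕ) : K) - ((min l k : ℕ) : K)) • current m l (current l k g) := by
    refine (Finset.sum_subset (Finset.range_subset_range.2 hN) fun l _ hl => ?_).symm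
    rw [current_eq_zero hg (by simpa using hl), map_zero, smul_zero]
  have h2 := C_inv_two_mul_two
  rcases lt_trichotomy m k with h | rfl | h
  · obtain ⟨r, rfl⟩ := Nat.exists_eq_add_of_lt h
    rw [add_assoc m r 1] at *
    generalize hn : r + 1 = n at *
    have hg' : BoundedBy (n + S + 1) g := fun i hi => hg i (by omega)
    rw [hsum hM, ← hsum (N := m + (n + (n + S + 1))) (by omega), sum_current_current_add_right,
      current_add_right, current_add_right, Dalpha_pHat_mul (by omega) (by omega) hg',
      min_eq_left (by omega)]
    simp only [smul_eq_C_mul, map_mul, map_sub, map_add, map_one, Nat.cast_add] at h2 ⊢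
    grind
  · have : ∀ l ∈ Finset.range M,
        (((min m l : ℕ) : K) - ((min l m : ℕ) : K)) • current m l (current l m g) = 0 := by
      intro l _
      rw [min_comm, sub_self, zero_smul]
    rw [Finset.sum_eq_zero this]
    simp [current_self, ← linD_apply]
  · obtain ⟨r, rfl⟩ := Nat.exists_eq_add_of_lt h
    rw [add_assoc k r 1] at *
    generalize hn : r + 1 = n at *
    have hg' : BoundedBy (n + S + 1) g := fun i hi => hg i (by omega)
    rw [hsum hM, ← hsum (N := k + (n + (n + S + 1))) (by omega), sum_current_current_add_left,
      current_add_left, current_add_left, dP_Dalpha (by omega) (by omega) hg',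
      min_eq_right (by omega), ← linD_apply, map_smul, linD_apply]
    simp only [smul_eq_C_mul, map_mul, map_sub, map_add, map_one, Nat.cast_add] at h2 ⊢
    grind

/-- `g` involves none of the variables `y_i`. -/
def YFree (g : R) : Prop := ∀ i, dY i g = 0

lemma dY_Y_mul (j k : ℕ) {g : R} (hg : YFree g) :
    dY j (Y k * g) = if j = k then g else 0 := by
  rw [dY_mul, hg, dY_Y]
  simp

lemma dP_Y_mul (j k : ℕ) (g : R) : dP j (Y k * g) = Y k * dP j g := by
  rw [dP_mul, dP_Y, zero_mul, add_zero]

lemma boundedBy_Y_mul {k T : ℕ} {g : R} (hk : k < T) (hg : BoundedBy T g) :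
    BoundedBy T (Y k * g) := fun i hi => by
  have : i ≠ k := by omega
  simp [dP_mul, dY_mul, hg i hi, dP_Y, dY_Y, this]

lemma YFree.dP {g : R} (hg : YFree g) (i : ℕ) : YFree (dP i g) := fun j => by
  rw [← dP_dY_comm, hg, dP_zero]

lemma YFree.smul {g : R} (hg : YFree g) (c : K) : YFree (c • g) := fun j => by
  rw [dY_smul, hg, smul_zero]

lemma YFree.pHat_mul {g : R} (hg : YFree g) (n : ℕ) : YFree (pHat n * g) := fun j => by
  rw [dY_mul, hg, dY_pHat, mul_zero, zero_mul, add_zero]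

lemma YFree.current {g : R} (hg : YFree g) (m k : ℕ) : YFree (current m k g) := by
  rcases le_total m k with h | h <;> obtain ⟨n, rfl⟩ := Nat.exists_eq_add_of_le h
  · rw [current_add_right]
    exact hg.pHat_mul n
  · rw [current_add_left]
    exact (hg.dP n).smul _

lemma BoundedBy.current {k T : ℕ} {g : R} (hg : BoundedBy T g) (hk : k < T) (m : ℕ) :
    BoundedBy T (current m k g) := by
  rcases le_total m k with h | h <;> obtain ⟨n, rfl⟩ := Nat.exists_eq_add_of_le h
  · rw [current_add_right]
    intro i hi
    have : i ≠ n := by omega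
    rw [dP_mul, dY_mul, dY_pHat, dP_pHat (by omega), if_neg this]
    simp [hg i hi]
  · rw [current_add_left]
    intro i hi
    rw [dP_smul, dY_smul, dP_dP_comm, ← dP_dY_comm]
    simp [hg i hi]

lemma YFree.Dalpha {g : R} (hg : YFree g) : YFree (Dalpha g) := by
  obtain ⟨T, hT⟩ := exists_boundedBy g
  intro l
  have h0 (a : R) (i : ℕ) : dY l (a * _root_.dP i g) = dY l a * _root_.dP i g := by
    rw [dY_mul, hg.dP, mul_zero, zero_add]
  have h1 (a : R) (i j : ℕ) : dY l (a * _root_.dP i (_root_.dP j g)) =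
      dY l a * _root_.dP i (_root_.dP j g) := by
    rw [dY_mul, (hg.dP _).dP, mul_zero, zero_add]
  rw [Dalpha_eq_truncD (hT T le_rfl)]
  simp [truncD, dY_smul, dY_add, dY_sum, h0, h1, dY_pHat, dY_mul _ (pHat _) (pHat _)]

lemma Dalpha_Y_mul (k : ℕ) (g : R) : Dalpha (Y k * g) = Y k * Dalpha g := by
  obtain ⟨T, hT⟩ := exists_boundedBy g
  have hg := hT (k + T + 1) (by omega)
  rw [Dalpha_eq_truncD hg, Dalpha_eq_truncD (boundedBy_Y_mul (by omega) hg)]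
  simp only [truncD, dP_Y_mul, mul_add, mul_smul_comm, Finset.mul_sum, mul_left_comm (Y k)]

lemma sum_range_Y_mul_current {k T M : ℕ} {g : R} (hg : BoundedBy T g) (hM : k + T ≤ M)
    (c : ℕ → K) :
    ∑ m ∈ Finset.range M, Y m * c m • current m k g =
      (∑ t ∈ Finset.range (k + 1), c t • (Y t * pHat (k - t) * g)) +
        alpha • ∑ i ∈ Finset.range T, c (k + i) • (i : K) • (Y (k + i) * dP i g) := by
  have h0 : ∑ m ∈ Finset.range M, Y m * c m • current m k g =
      ∑ m ∈ Finset.range (k + T), Y m * c m • current m k g := by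
    refine (Finset.sum_subset (Finset.range_subset_range.2 hM) fun l _ hl => ?_).symm
    rw [current_eq_zero hg (by simpa using hl), smul_zero, mul_zero]
  rw [h0, Finset.sum_range_add, Finset.sum_range_succ, Nat.sub_self, pHat_zero, mul_zero, zero_mul,
    smul_zero, add_zero, Finset.smul_sum]
  congr 1
  · refine Finset.sum_congr rfl fun t ht => ?_
    obtain ⟨r, rfl⟩ := Nat.exists_eq_add_of_lt (Finset.mem_range.1 ht)
    rw [add_assoc t r 1, current_add_right, Nat.add_sub_cancel_left, mul_smul_comm, mul_assoc]
  · refine Finset.sum_congr rfl fun t _ => ?_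
    rw [current_add_left, mul_smul_comm, mul_smul_comm, smul_smul, smul_smul, smul_smul]
    ring_nf

lemma LamY_Y_mul {k T M : ℕ} {g : R} (hY : YFree g) (hg : BoundedBy T g) (hk : k < T)
    (hM : k + T ≤ M) :
    LamY (Y k * g) = ∑ m ∈ Finset.range M, Y m * current m k g + (bb * k) • (Y k * g) := by
  have hs := sum_range_Y_mul_current hg hM fun _ => 1
  simp only [one_smul] at hs
  rw [LamY_eq_truncLam (boundedBy_Y_mul hk hg), hs, truncLam]
  simp only [dY_Y_mul _ _ hY, apply_ite (dP _), dP_zero, mul_ite, mul_zero, smul_ite, smul_zero,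
    Finset.sum_ite_eq', Finset.mem_range, if_pos hk, sum_range_sum_range_ite_add hk, smul_smul,
    add_comm k]
  ring

lemma D'alpha_Y_mul {k T M : ℕ} {g : R} (hY : YFree g) (hg : BoundedBy T g) (hk : k < T)
    (hM : k + T ≤ M) :
    D'alpha (Y k * g) = ∑ m ∈ Finset.range M, Y m * ((min m k : ℕ) : K) • current m k g +
      (bb * 2⁻¹ * (k * (k - 1))) • (Y k * g) := by
  have hs := sum_range_Y_mul_current hg hM fun m => ((min m k : ℕ) : K)
  have h1 : ∑ t ∈ Finset.range (k + 1), ((min t k : ℕ) : K) • (Y t * pHat (k - t) * g) =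
      ∑ t ∈ Finset.range (k + 1), (t : K) • (Y t * pHat (k - t) * g) :=
    Finset.sum_congr rfl fun t ht => by
      rw [min_eq_left (by simpa [Nat.lt_succ_iff] using ht)]
  have h2 (i : ℕ) : min (k + i) k = k := min_eq_right (by omega)
  have h3 : (k : K) * ((k - 1 : ℕ) : K) = k * (k - 1) := by
    rcases k with _ | k <;> simp
  simp only [h1, h2] at hs
  rw [D'alpha_eq_truncD' (boundedBy_Y_mul hk hg), hs, truncD', Finset.sum_comm (γ := ℕ)]
  simp only [dP_Y_mul, dY_Y_mul _ _ hY, dY_Y_mul _ _ (hY.dP _), mul_ite, mul_zero, smul_ite,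
    smul_zero, Finset.sum_ite_eq', Finset.mem_range, if_pos hk, sum_range_sum_range_ite_add hk,
    smul_smul, Nat.cast_mul, h3]
  ring

lemma commutator_Y_mul (k : ℕ) {g : R} (hY : YFree g) :
    Dalpha (LamY (Y k * g)) + D'alpha (LamY (Y k * g)) =
      LamY (Dalpha (Y k * g) + D'alpha (Y k * g)) := by
  obtain ⟨T₁, h₁⟩ := exists_boundedBy g
  obtain ⟨T₂, h₂⟩ := exists_boundedBy (Dalpha g)
  obtain ⟨T, hk, hg, hDg⟩ : ∃ T, k < T ∧ BoundedBy T g ∧ BoundedBy T (Dalpha g) :=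
    ⟨k + T₁ + T₂ + 1, by omega, h₁ _ (by omega), h₂ _ (by omega)⟩
  have hk2 : k < 2 * T := by omega
  have hg2 : BoundedBy (2 * T) g := fun i hi => hg i (by omega)
  -- `y_l` occurs with nonzero coefficient only for `l < 2 * T`
  have hLam (l : ℕ) : LamY (Y l * current l k g) =
      ∑ m ∈ Finset.range (4 * T), Y m * current m l (current l k g)
        + (bb * l) • (Y l * current l k g) := by
    by_cases hl : l < 2 * T
    · exact LamY_Y_mul (hY.current l k) (hg2.current hk2 l) hl (by omega)
    · simp [current_eq_zero hg (show k + T ≤ l by omega), ← linLam_apply]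
  have hD' (l : ℕ) : D'alpha (Y l * current l k g) =
      ∑ m ∈ Finset.range (4 * T), Y m * ((min m l : ℕ) : K) • current m l (current l k g)
        + (bb * 2⁻¹ * (l * (l - 1))) • (Y l * current l k g) := by
    by_cases hl : l < 2 * T
    · exact D'alpha_Y_mul (hY.current l k) (hg2.current hk2 l) hl (by omega)
    · simp [current_eq_zero hg (show k + T ≤ l by omega), ← linD'_apply]
  have hM : k + T ≤ 4 * T := by omega
  have key (m : ℕ) := Dalpha_current m hg hM
  rw [Dalpha_Y_mul, ← linLam_apply, ← linLam_apply, map_add, linLam_apply, linLam_apply,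
    linLam_apply, LamY_Y_mul hY.Dalpha hDg hk hM, D'alpha_Y_mul hY hg hk hM,
    LamY_Y_mul hY hg hk hM]
  simp only [← linLam_apply, ← linD_apply, ← linD'_apply, map_add, map_sum, map_smul,
    mul_smul_comm]
  simp only [linLam_apply, linD_apply, linD'_apply, hLam, hD', Dalpha_Y_mul,
    LamY_Y_mul hY hg hk hM, D'alpha_Y_mul hY hg hk hM, ← key]
  simp only [mul_add, smul_add, Finset.sum_add_distrib, Finset.smul_sum, mul_smul_comm, smul_smul,
    sub_smul, Finset.sum_sub_distrib]
  simp only [fun a b c : R => mul_sub a b c, Finset.sum_sub_distrib, Finset.mul_sum, mul_smul_comm]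
  have hdiag : ∑ m ∈ Finset.range (4 * T), (bb * 2⁻¹ * (m * (m - 1))) • (Y m * current m k g)
        + ∑ m ∈ Finset.range (4 * T), (bb * k * (min m k : ℕ)) • (Y m * current m k g) =
      ∑ m ∈ Finset.range (4 * T), (bb * 2⁻¹ * (m * (m - 1) - k * (k - 1))
          + bb * (min m k : ℕ) * (k - m)) • (Y m * current m k g)
        + ∑ m ∈ Finset.range (4 * T), ((min m k : ℕ) * (bb * m)) • (Y m * current m k g)
        + ∑ m ∈ Finset.range (4 * T), (bb * 2⁻¹ * (k * (k - 1))) • (Y m * current m k g) := by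
    simp only [← Finset.sum_add_distrib, ← add_smul]
    refine Finset.sum_congr rfl fun m _ => ?_
    congr 1
    ring
  have hmin : ∑ l ∈ Finset.range (4 * T), ∑ m ∈ Finset.range (4 * T),
        ((min m l : ℕ) : K) • (Y m * current m l (current l k g)) =
      ∑ m ∈ Finset.range (4 * T), ∑ l ∈ Finset.range (4 * T),
        ((min m l : ℕ) : K) • (Y m * current m l (current l k g)) := Finset.sum_comm
  have hmin' : ∑ l ∈ Finset.range (4 * T), ∑ m ∈ Finset.range (4 * T),
        ((min l k : ℕ) : K) • (Y m * current m l (current l k g)) =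
      ∑ m ∈ Finset.range (4 * T), ∑ l ∈ Finset.range (4 * T),
        ((min l k : ℕ) : K) • (Y m * current m l (current l k g)) := Finset.sum_comm
  rw [mul_comm (bb * 2⁻¹ * ((k : K) * (k - 1))) (bb * k), hmin, hmin']
  linear_combination (exp := 1) hdiag

/-- The commutator `[D_α + D′_α, Λ_Y]` vanishes on `𝒫_Y`
(relation (4.4a) of Chapuy–Dołęga). -/
theorem commutator_D_LamY_vanishes :
    ∀ f ∈ PY, Dalpha (LamY f) + D'alpha (LamY f) = LamY (Dalpha f + D'alpha f) := by
  intro f hf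
  have hfree {g : R} (hg : g ∈ (Psub : Set R)) : YFree g := fun i =>
    pderiv_eq_zero_of_notMem_vars fun hv => by
      simpa using mem_supported.1 hg hv
  induction hf using Submodule.span_induction with
  | mem x hx =>
    rcases hx with hx | ⟨k, g, hg, rfl⟩
    · have h0 {g : R} (hg : YFree g) : LamY g = 0 ∧ D'alpha g = 0 := by
        have hgP (i j : ℕ) : dY i (dP j g) = 0 := hg.dP j i
        constructor
        · simp [LamY, hg _]
        · simp [D'alpha, hg _, hgP]
      have hx := hfree hx
      rw [(h0 hx).1, (h0 hx).2, add_zero, (h0 hx.Dalpha).1, ← linD_apply, ← linD'_apply]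
      simp
    · exact commutator_Y_mul k (hfree hg)
  | zero => simp [← linD_apply, ← linD'_apply, ← linLam_apply]
  | add x y _ _ hx hy =>
    simp only [← linD_apply, ← linD'_apply, ← linLam_apply, map_add] at hx hy ⊢
    linear_combination hx + hy
  | smul c x _ hx =>
    simp only [← linD_apply, ← linD'_apply, ← linLam_apply, map_smul, ← smul_add] at hx ⊢
    rw [hx]
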